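/- For each n ≥ 2 let U^{(n)} be Haar distributed on the unitary group U(n) and set T^{(n)}_{p,q} = Σ_{i≤p, j≤q} |U^{(n)}_{ij}|². Let p(n), p'(n), q(n), q'(n) be sequences in {1,…,n} with p(n)/n → s, p'(n)/n → s', q(n)/n → t, q'(n)/n → t' for s, s', t, t' ∈ [0,1]. Then Cov(T^{(n)}_{p(n),q(n)}, T^{(n)}_{p'(n),q'(n)}) → (s∧s' − s s')(t∧t' − t t') as n → ∞. -/

import Mathlib

open MeasureTheory Matrix Filter

/-- The entrywise (Borel) measurable structure on matrices. -/
instance matrixMeasurableSpace {m n α : Type*} [MeasurableSpace α] :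
    MeasurableSpace (Matrix m n α) :=
  inferInstanceAs (MeasurableSpace (m → n → α))

/-- `T_{p,q} = Σ_{1 ≤ i ≤ p, 1 ≤ j ≤ q} |U_{ij}|²`. -/
noncomputable def truncTraceU (n p q : ℕ) (U : Matrix.unitaryGroup (Fin n) ℂ) : ℝ :=
  ∑ i : Fin n, ∑ j : Fin n,
    if (i : ℕ) < p ∧ (j : ℕ) < q then ‖(U : Matrix (Fin n) (Fin n) ℂ) i j‖ ^ 2 else 0

instance instBorelMat (n : ℕ) : BorelSpace (Matrix (Fin n) (Fin n) ℂ) :=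
  inferInstanceAs (BorelSpace (Fin n → Fin n → ℂ))

instance instCompactU (n : ℕ) : CompactSpace (Matrix.unitaryGroup (Fin n) ℂ) := by
  apply isCompact_iff_compactSpace.1
  have h1 : IsCompact (Set.univ.pi fun _ : Fin n => Set.univ.pi fun _ : Fin n =>
      Metric.closedBall (0:ℂ) 1) :=
    isCompact_univ_pi fun _ => isCompact_univ_pi fun _ => isCompact_closedBall _ _
  refine IsCompact.of_isClosed_subset (X := Fin n → Fin n → ℂ) h1 ?_ ?_
  · have : IsClosed {A : Matrix (Fin n) (Fin n) ℂ | A * star A = 1} :=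
      isClosed_eq (by fun_prop) continuous_const
    have e : {A : Matrix (Fin n) (Fin n) ℂ | A * star A = 1} =
        (Matrix.unitaryGroup (Fin n) ℂ : Set (Matrix (Fin n) (Fin n) ℂ)) := by
      ext A
      exact Matrix.mem_unitaryGroup_iff.symm
    rw [e] at this
    exact this
  · intro A hA
    simp only [Set.mem_pi, Set.mem_univ, true_imp_iff, mem_closedBall_zero_iff]
    exact fun i j => entry_norm_bound_of_unitary hA i j

section
variable {n : ℕ}


lemma u_int (ν : Measure (Matrix.unitaryGroup (Fin n) ℂ)) [IsProbabilityMeasure ν] {f : Matrix.unitaryGroup (Fin n) ℂ → ℝ} (hf : Continuous f) :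
    Integrable f ν :=
  hf.integrable_of_hasCompactSupport (HasCompactSupport.of_compactSpace f)

lemma u_cont (i j : Fin n) : Continuous fun U : Matrix.unitaryGroup (Fin n) ℂ => (U : Matrix (Fin n) (Fin n) ℂ) i j :=
  continuous_subtype_val.matrix_elem i j

lemma u_inv (ν : Measure (Matrix.unitaryGroup (Fin n) ℂ)) [ν.IsMulLeftInvariant] (V : Matrix.unitaryGroup (Fin n) ℂ) (f : (Matrix.unitaryGroup (Fin n) ℂ) → ℝ) :
    ∫ U, f (V * U) ∂ν = ∫ U, f U ∂ν := integral_mul_left_eq_self f V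

/-- permutation matrix -/
lemma exists_perm (σ : Equiv.Perm (Fin n)) : ∃ V : Matrix.unitaryGroup (Fin n) ℂ, ∀ (U : Matrix.unitaryGroup (Fin n) ℂ) i j,
    ((V * U : Matrix.unitaryGroup (Fin n) ℂ) : Matrix (Fin n) (Fin n) ℂ) i j = (U : Matrix (Fin n) (Fin n) ℂ) (σ i) j := by
  refine ⟨⟨(1 : Matrix (Fin n) (Fin n) ℂ).submatrix σ id, ?_⟩, ?_⟩
  · rw [Matrix.mem_unitaryGroup_iff]
    ext i j
    simp [Matrix.mul_apply, Matrix.one_apply, Matrix.star_apply]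
  · intro U i j
    simp [Matrix.mul_apply, Matrix.one_apply]

/-- Householder reflection with prescribed first row. -/
lemma exists_rot {i k : Fin n} (hik : i ≠ k) (w : ℂ) (hw : star w * w = 1) :
    ∃ V : Matrix.unitaryGroup (Fin n) ℂ, ∀ (U : Matrix.unitaryGroup (Fin n) ℂ) j, ((V * U : Matrix.unitaryGroup (Fin n) ℂ) : Matrix (Fin n) (Fin n) ℂ) i j =
      3/5 * (U : Matrix (Fin n) (Fin n) ℂ) i j + 4/5 * w * (U : Matrix (Fin n) (Fin n) ℂ) k j := by
  set v : Fin n → ℂ := Pi.single i 1 - Pi.single k (2 * star w) with hv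
  have hvi : v i = 1 := by simp [hv, hik]
  have hvk : v k = -(2 * star w) := by simp [hv, hik.symm]
  have hsv : star v = Pi.single i 1 - Pi.single k (2 * w) := by
    ext a
    simp only [hv, Pi.star_apply, Pi.sub_apply, Pi.single_apply]
    split_ifs <;> simp
  have hvv : star v ⬝ᵥ v = 5 := by
    rw [hsv, sub_dotProduct, single_dotProduct, single_dotProduct, hvi, hvk]
    linear_combination 4 * hw
  have hst : star (1 - (2/5 : ℂ) • vecMulVec v (star v)) = 1 - (2/5 : ℂ) • vecMulVec v (star v) := by
    ext a b
    have h1 : star ((1 : Matrix (Fin n) (Fin n) ℂ) b a) = (1 : Matrix (Fin n) (Fin n) ℂ) a b := by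
      simp only [Matrix.one_apply, eq_comm]
      split_ifs <;> simp
    simp only [Matrix.star_apply, Matrix.sub_apply, Matrix.smul_apply, star_sub, h1,
      vecMulVec_apply, smul_eq_mul, Pi.star_apply, star_mul, star_star]
    have h2 : star (2/5 : ℂ) = 2/5 := by simp
    rw [h2]
    ring
  refine ⟨⟨1 - (2/5 : ℂ) • vecMulVec v (star v), ?_⟩, ?_⟩
  · rw [Matrix.mem_unitaryGroup_iff, hst]
    have : vecMulVec v (star v) * vecMulVec v (star v) = (5:ℂ) • vecMulVec v (star v) := by
      rw [vecMulVec_mul_vecMulVec, hvv]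
      ext a b
      simp [vecMulVec_apply]
      try ring
    simp only [sub_mul, mul_sub, one_mul, mul_one, smul_mul_assoc, mul_smul_comm, this, smul_smul]
    module
  · intro U j
    have : (vecMulVec v (star v) * (U : Matrix (Fin n) (Fin n) ℂ)) i j
        = (U : Matrix (Fin n) (Fin n) ℂ) i j - 2 * w * (U : Matrix (Fin n) (Fin n) ℂ) k j := by
      rw [vecMulVec_mul, vecMulVec_apply, hvi, one_mul, hsv]
      simp [sub_vecMul, single_vecMul]
    simp only [Submonoid.coe_mul, sub_mul, one_mul, smul_mul_assoc, Matrix.sub_apply,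
      Matrix.smul_apply, this, smul_eq_mul]
    ring

lemma perm2 {i k i' k' : Fin n} (h : i ≠ k) (h' : i' ≠ k') :
    ∃ σ : Equiv.Perm (Fin n), σ i = i' ∧ σ k = k' := by
  refine ⟨Equiv.swap (Equiv.swap i i' k) k' * Equiv.swap i i', ?_, ?_⟩
  · rw [Equiv.Perm.mul_apply, Equiv.swap_apply_left]
    apply Equiv.swap_apply_of_ne_of_ne _ h'
    intro hh
    apply h
    apply (Equiv.swap i i').injective
    rw [Equiv.swap_apply_left, ← hh]
  · simp

lemma col_orth (U : Matrix.unitaryGroup (Fin n) ℂ) (j l : Fin n) :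
    ∑ i, star ((U : Matrix (Fin n) (Fin n) ℂ) i j) * (U : Matrix (Fin n) (Fin n) ℂ) i l
      = if j = l then 1 else 0 := by
  have := congrFun (congrFun (Matrix.mem_unitaryGroup_iff'.1 U.2) j) l
  rwa [Matrix.mul_apply, Matrix.one_apply] at this

lemma col_norm (U : Matrix.unitaryGroup (Fin n) ℂ) (j : Fin n) :
    ∑ i, ‖(U : Matrix (Fin n) (Fin n) ℂ) i j‖ ^ 2 = 1 := by
  have := congrArg Complex.re (col_orth U j j)
  simpa [Complex.sq_norm, Complex.normSq_apply] using this

/-- The mixed term. -/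
noncomputable def mixF (j l i k : Fin n) (U : Matrix.unitaryGroup (Fin n) ℂ) : ℝ :=
  (star ((U : Matrix (Fin n) (Fin n) ℂ) i j) * (U : Matrix (Fin n) (Fin n) ℂ) i l *
    star (star ((U : Matrix (Fin n) (Fin n) ℂ) k j) * (U : Matrix (Fin n) (Fin n) ℂ) k l)).re

noncomputable def xx (i j k l : Fin n) (U : Matrix.unitaryGroup (Fin n) ℂ) : ℝ :=
  ‖(U : Matrix (Fin n) (Fin n) ℂ) i j‖ ^ 2 * ‖(U : Matrix (Fin n) (Fin n) ℂ) k l‖ ^ 2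

lemma mixF_cont (j l i k : Fin n) : Continuous (mixF (n := n) j l i k) := by
  have := @u_cont n
  unfold mixF
  exact Complex.continuous_re.comp ((((this i j).star).mul (this i l)).mul
    ((((this k j).star).mul (this k l)).star))

lemma xx_cont (i j k l : Fin n) : Continuous (xx (n := n) i j k l) := by
  have := @u_cont n
  unfold xx
  exact ((this i j).norm.pow 2).mul ((this k l).norm.pow 2)

lemma mixF_sum (j l : Fin n) (U : Matrix.unitaryGroup (Fin n) ℂ) : ∑ i, ∑ k, mixF j l i k U = if j = l then 1 else 0 := by
  have h := col_orth U j l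
  have : ∑ i, ∑ k, mixF j l i k U = ((∑ i, star ((U : Matrix (Fin n) (Fin n) ℂ) i j) *
      (U : Matrix (Fin n) (Fin n) ℂ) i l) * star (∑ i, star ((U : Matrix (Fin n) (Fin n) ℂ) i j) *
      (U : Matrix (Fin n) (Fin n) ℂ) i l)).re := by
    rw [star_sum, Finset.sum_mul_sum, Complex.re_sum]
    refine Finset.sum_congr rfl fun i _ => ?_
    rw [Complex.re_sum]
    rfl
  rw [this, h]
  split_ifs <;> simp

lemma xx_sum (i j l : Fin n) (U : Matrix.unitaryGroup (Fin n) ℂ) :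
    ∑ k, xx i j k l U = ‖(U : Matrix (Fin n) (Fin n) ℂ) i j‖ ^ 2 := by
  simp only [xx]
  rw [← Finset.mul_sum, col_norm, mul_one]

lemma rot_ident (a b c d : ℂ) :
    ‖3/5 * a + 4/5 * 1 * c‖ ^ 2 * ‖3/5 * b + 4/5 * 1 * d‖ ^ 2
    + ‖3/5 * a + 4/5 * (-1) * c‖ ^ 2 * ‖3/5 * b + 4/5 * (-1) * d‖ ^ 2
    + ‖3/5 * a + 4/5 * Complex.I * c‖ ^ 2 * ‖3/5 * b + 4/5 * Complex.I * d‖ ^ 2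
    + ‖3/5 * a + 4/5 * (-Complex.I) * c‖ ^ 2 * ‖3/5 * b + 4/5 * (-Complex.I) * d‖ ^ 2
    = 4 * (81/625 * (‖a‖^2 * ‖b‖^2) + 256/625 * (‖c‖^2 * ‖d‖^2)
      + 144/625 * (‖a‖^2 * ‖d‖^2) + 144/625 * (‖c‖^2 * ‖b‖^2)
      + 288/625 * (star a * b * star (star c * d)).re) := by
  have e3 : (3/5 : ℂ) = ((3/5 : ℝ) : ℂ) := by push_cast; rfl
  have e4 : (4/5 : ℂ) = ((4/5 : ℝ) : ℂ) := by push_cast; rfl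
  rw [e3, e4]
  simp only [Complex.sq_norm, Complex.normSq_apply, Complex.add_re, Complex.add_im, Complex.mul_re,
    Complex.mul_im, Complex.ofReal_re, Complex.ofReal_im, Complex.one_re, Complex.one_im,
    Complex.neg_re, Complex.neg_im, Complex.I_re, Complex.I_im, Complex.star_def, Complex.conj_re,
    Complex.conj_im]
  ring

variable (ν : Measure (Matrix.unitaryGroup (Fin n) ℂ)) [IsProbabilityMeasure ν] [ν.IsMulLeftInvariant]

lemma ex1 (i j : Fin n) : ∫ U : Matrix.unitaryGroup (Fin n) ℂ, ‖(U : Matrix (Fin n) (Fin n) ℂ) i j‖ ^ 2 ∂ν = 1 / n := by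
  have hn : (n : ℝ) ≠ 0 := by
    have := i.pos
    positivity
  have hc : ∀ k, ∫ U : Matrix.unitaryGroup (Fin n) ℂ, ‖(U : Matrix (Fin n) (Fin n) ℂ) k j‖ ^ 2 ∂ν =
      ∫ U : Matrix.unitaryGroup (Fin n) ℂ, ‖(U : Matrix (Fin n) (Fin n) ℂ) i j‖ ^ 2 ∂ν := by
    intro k
    obtain ⟨V, hV⟩ := exists_perm (Equiv.swap i k)
    rw [← u_inv ν V fun U => ‖(U : Matrix (Fin n) (Fin n) ℂ) i j‖ ^ 2]
    simp [hV]
  have hs : ∑ k, ∫ U : Matrix.unitaryGroup (Fin n) ℂ, ‖(U : Matrix (Fin n) (Fin n) ℂ) k j‖ ^ 2 ∂ν = 1 := by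
    rw [← integral_finsetSum]
    · simp [col_norm]
    · exact fun k _ => u_int ν ((u_cont k j).norm.pow 2)
  simp only [hc, Finset.sum_const, Finset.card_univ, Fintype.card_fin, nsmul_eq_mul] at hs
  field_simp
  linarith

lemma xx_perm (σ : Equiv.Perm (Fin n)) (i j k l : Fin n) :
    ∫ U, xx (σ i) j (σ k) l U ∂ν = ∫ U, xx i j k l U ∂ν := by
  obtain ⟨V, hV⟩ := exists_perm σ
  rw [← u_inv ν V (xx i j k l)]
  simp only [xx, hV]

lemma xx_diag (i k j l : Fin n) : ∫ U, xx i j i l U ∂ν = ∫ U, xx k j k l U ∂ν := by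
  have := xx_perm ν (Equiv.swap i k) k j k l
  simpa using this

lemma xx_off {i k i' k' : Fin n} (h : i ≠ k) (h' : i' ≠ k') (j l : Fin n) :
    ∫ U, xx i j k l U ∂ν = ∫ U, xx i' j k' l U ∂ν := by
  obtain ⟨σ, h1, h2⟩ := perm2 h h'
  rw [← xx_perm ν σ, h1, h2]

lemma xx_rot {i k : Fin n} (h : i ≠ k) (j l : Fin n) :
    ∫ U, xx i j i l U ∂ν = ∫ U, xx i j k l U ∂ν + ∫ U, mixF j l i k U ∂ν := by
  have key : ∀ w : ℂ, star w * w = 1 → ∫ U, xx i j i l U ∂ν =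
      ∫ U : Matrix.unitaryGroup (Fin n) ℂ, ‖3/5 * (U : Matrix (Fin n) (Fin n) ℂ) i j + 4/5 * w * (U : Matrix (Fin n) (Fin n) ℂ) k j‖ ^ 2
      * ‖3/5 * (U : Matrix (Fin n) (Fin n) ℂ) i l + 4/5 * w * (U : Matrix (Fin n) (Fin n) ℂ) k l‖ ^ 2 ∂ν := by
    intro w hw
    obtain ⟨V, hV⟩ := exists_rot h w hw
    rw [← u_inv ν V (xx i j i l)]
    simp only [xx, hV]
  have hrInt : ∀ w : ℂ, Integrable (fun U : Matrix.unitaryGroup (Fin n) ℂ =>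
      ‖3/5 * (U : Matrix (Fin n) (Fin n) ℂ) i j + 4/5 * w * (U : Matrix (Fin n) (Fin n) ℂ) k j‖ ^ 2
      * ‖3/5 * (U : Matrix (Fin n) (Fin n) ℂ) i l + 4/5 * w * (U : Matrix (Fin n) (Fin n) ℂ) k l‖ ^ 2) ν := by
    intro w
    have := @u_cont n
    apply u_int
    exact (((continuous_const.mul (this i j)).add (continuous_const.mul (this k j))).norm.pow 2).mul
      (((continuous_const.mul (this i l)).add (continuous_const.mul (this k l))).norm.pow 2)
  have hx : ∀ a b c d, Integrable (xx a b c d) ν := fun a b c d => u_int ν (xx_cont a b c d)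
  have hf : Integrable (mixF j l i k) ν := u_int ν (mixF_cont j l i k)
  have e : 4 * ∫ U, xx i j i l U ∂ν = 4 * (81/625 * ∫ U, xx i j i l U ∂ν
      + 256/625 * ∫ U, xx k j k l U ∂ν + 144/625 * ∫ U, xx i j k l U ∂ν
      + 144/625 * ∫ U, xx k j i l U ∂ν + 288/625 * ∫ U, mixF j l i k U ∂ν) := by
    calc _ = ∫ U, xx i j i l U ∂ν + ∫ U, xx i j i l U ∂ν + ∫ U, xx i j i l U ∂ν
          + ∫ U, xx i j i l U ∂ν := by ring
      _ = _ := by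
        nth_rewrite 1 [key 1 (by simp)]
        nth_rewrite 1 [key (-1) (by simp)]
        nth_rewrite 1 [key Complex.I (by simp)]
        nth_rewrite 1 [key (-Complex.I) (by simp)]
        rw [← integral_add (hrInt _) (hrInt _), ← integral_add ((hrInt _).fun_add (hrInt _)) (hrInt _),
          ← integral_add (((hrInt _).fun_add (hrInt _)).fun_add (hrInt _)) (hrInt _)]
        simp only [← integral_const_mul]
        rw [← integral_add ((hx _ _ _ _).const_mul _) ((hx _ _ _ _).const_mul _),
          ← integral_add (((hx _ _ _ _).const_mul _).fun_add ((hx _ _ _ _).const_mul _))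
            ((hx _ _ _ _).const_mul _),
          ← integral_add ((((hx _ _ _ _).const_mul _).fun_add ((hx _ _ _ _).const_mul _)).fun_add
            ((hx _ _ _ _).const_mul _)) ((hx _ _ _ _).const_mul _),
          ← integral_add (((((hx _ _ _ _).const_mul _).fun_add ((hx _ _ _ _).const_mul _)).fun_add
            ((hx _ _ _ _).const_mul _)).fun_add ((hx _ _ _ _).const_mul _)) (hf.const_mul _),
          ← integral_const_mul]
        congr 1
        ext U
        exact rot_ident _ _ _ _
  rw [xx_diag ν k i, xx_off ν h.symm h] at e
  linarith

lemma mixF_self (i j l : Fin n) (U : Matrix.unitaryGroup (Fin n) ℂ) :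
    mixF j l i i U = xx i j i l U := by
  simp only [mixF, xx, Complex.sq_norm, Complex.normSq_apply, Complex.mul_re,
    Complex.mul_im, Complex.star_def, Complex.conj_re, Complex.conj_im]
  ring

lemma xx_B (i j l : Fin n) :
    ∫ U, xx i j i l U ∂ν = (1 + if j = l then 1 else 0) / (n * (n + 1)) := by
  have hn : (n : ℝ) ≠ 0 := by
    have := i.pos
    positivity
  have hn1 : (n : ℝ) + 1 ≠ 0 := by positivity
  have h1 : ∑ a, ∑ b, (∫ U, xx a j b l U ∂ν + ∫ U, mixF j l a b U ∂ν)
      = 1 + if j = l then 1 else 0 := by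
    simp only [Finset.sum_add_distrib]
    congr 1
    · have : ∀ a, ∑ b, ∫ U, xx a j b l U ∂ν = 1 / n := by
        intro a
        rw [← integral_finsetSum _ fun b _ => u_int ν (xx_cont a j b l)]
        simp only [xx_sum]
        exact ex1 ν a j
      simp [this, hn]
    · have : ∀ a, ∑ b, ∫ U, mixF j l a b U ∂ν = ∫ U, ∑ b, mixF j l a b U ∂ν := fun a =>
        (integral_finsetSum _ fun b _ => u_int ν (mixF_cont j l a b)).symm
      simp only [this]
      rw [← integral_finsetSum _ fun a _ => u_int ν
        (continuous_finsetSum _ fun b _ => mixF_cont j l a b)]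
      simp only [mixF_sum]
      simp
  have h2 : ∀ a b, (∫ U, xx a j b l U ∂ν + ∫ U, mixF j l a b U ∂ν)
      = ∫ U, xx i j i l U ∂ν + if a = b then ∫ U, xx i j i l U ∂ν else 0 := by
    intro a b
    split_ifs with h
    · subst h
      simp only [mixF_self]
      rw [xx_diag ν a i]
    · rw [← xx_rot ν h, xx_diag ν a i, add_zero]
  simp only [h2, Finset.sum_add_distrib, Finset.sum_const, Finset.card_univ, Fintype.card_fin,
    nsmul_eq_mul, Finset.sum_ite_eq, Finset.mem_univ, if_true] at h1
  rw [eq_div_iff (by positivity), ← h1]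
  ring

lemma xx_D {i k : Fin n} (h : i ≠ k) (j l : Fin n) :
    ∫ U, xx i j k l U ∂ν = (1 / n - (1 + if j = l then 1 else 0) / (n * (n + 1))) / (n - 1) := by
  have hn : (2 : ℝ) ≤ n := by
    have : 2 ≤ n := by
      have := i.2
      have := k.2
      have : (i : ℕ) ≠ k := fun e => h (Fin.ext e)
      omega
    exact_mod_cast this
  have h1 : ∑ b, ∫ U, xx i j b l U ∂ν = 1 / n := by
    rw [← integral_finsetSum _ fun b _ => u_int ν (xx_cont i j b l)]
    simp only [xx_sum]
    exact ex1 ν i j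
  have h2 : ∀ b, ∫ U, xx i j b l U ∂ν = ∫ U, xx i j k l U ∂ν +
      if i = b then ∫ U, xx i j i l U ∂ν - ∫ U, xx i j k l U ∂ν else 0 := by
    intro b
    split_ifs with hb
    · subst hb; ring
    · rw [add_zero, xx_off ν hb h]
  simp only [Finset.sum_congr rfl fun b _ => h2 b, Finset.sum_add_distrib, Finset.sum_const,
    Finset.card_univ, Fintype.card_fin,
    nsmul_eq_mul, Finset.sum_ite_eq, Finset.mem_univ, if_true] at h1
  rw [← xx_B ν i j l, ← h1, eq_div_iff (by linarith)]
  ring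

/-- Kronecker delta. -/
noncomputable def dl (i k : Fin n) : ℝ := if i = k then 1 else 0

lemma xx_M (hn : 2 ≤ n) (i j k l : Fin n) :
    ∫ U, xx i j k l U ∂ν =
      (1 + dl i k * dl j l - (dl i k + dl j l) / n) / ((n:ℝ)^2 - 1) := by
  have hn' : (2 : ℝ) ≤ n := by exact_mod_cast hn
  have e1 : (n:ℝ) ≠ 0 := by positivity
  have e2 : (n:ℝ) + 1 ≠ 0 := by positivity
  have e3 : (n:ℝ) - 1 ≠ 0 := by linarith
  have e4 : (n:ℝ)^2 - 1 = (n - 1) * (n + 1) := by ring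
  rw [e4]
  unfold dl
  by_cases h : i = k
  · subst h
    rw [xx_B]
    simp only [if_true]
    split_ifs <;> field_simp <;> ring
  · rw [xx_D ν h]
    split_ifs <;> field_simp <;> ring

/-- Indicator of the first `p` indices. -/
noncomputable def ind (p : ℕ) (i : Fin n) : ℝ := if (i : ℕ) < p then 1 else 0

lemma ind_sum {p : ℕ} (hp : p ≤ n) : ∑ i : Fin n, ind p i = p := by
  unfold ind
  rw [Fin.sum_univ_eq_sum_range (fun i => if i < p then (1:ℝ) else 0) n, Finset.sum_ite]
  have : (Finset.range n).filter (· < p) = Finset.range p := by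
    ext a
    simp
    omega
  simp [this]

lemma ind_dl {p p' : ℕ} (hp : p ≤ n) :
    ∑ i : Fin n, ∑ k : Fin n, ind p i * ind p' k * dl i k = (min p p' : ℕ) := by
  rw [← ind_sum (n := n) (p := min p p') (by omega)]
  refine Finset.sum_congr rfl fun i _ => ?_
  simp only [dl, mul_ite, mul_one, mul_zero, Finset.sum_ite_eq, Finset.mem_univ, if_true, ind,
    lt_min_iff]
  split_ifs <;> simp_all

lemma ind_one {p p' : ℕ} (hp : p ≤ n) (hp' : p' ≤ n) :
    ∑ i : Fin n, ∑ k : Fin n, ind p i * ind p' k = p * p' := by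
  rw [← Finset.sum_mul_sum, ind_sum hp, ind_sum hp']

lemma trunc_eq (p q : ℕ) (U : Matrix.unitaryGroup (Fin n) ℂ) : truncTraceU n p q U =
    ∑ i, ∑ j, ind p i * ind q j * ‖(U : Matrix (Fin n) (Fin n) ℂ) i j‖ ^ 2 := by
  unfold truncTraceU ind
  refine Finset.sum_congr rfl fun i _ => Finset.sum_congr rfl fun j _ => ?_
  split_ifs <;> simp_all

lemma trunc_int {p q : ℕ} (hp : p ≤ n) (hq : q ≤ n) :
    ∫ U, truncTraceU n p q U ∂ν = p * q / n := by
  simp only [trunc_eq]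
  have hI : ∀ i j, Continuous (fun U : Matrix.unitaryGroup (Fin n) ℂ =>
      ind p i * ind q j * ‖(U : Matrix (Fin n) (Fin n) ℂ) i j‖ ^ 2) := fun i j =>
    continuous_const.mul ((u_cont i j).norm.pow 2)
  rw [integral_finsetSum _ fun i _ => u_int ν (continuous_finsetSum _ fun j _ => hI i j)]
  simp only [integral_finsetSum _ fun j _ => u_int ν (hI _ j), integral_const_mul, ex1]
  simp only [← Finset.sum_mul]
  rw [ind_one hp hq]
  ring

lemma trunc_mul (p q p' q' : ℕ) (U : Matrix.unitaryGroup (Fin n) ℂ) :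
    truncTraceU n p q U * truncTraceU n p' q' U =
    ∑ i, ∑ k, ∑ j, ∑ l, (ind p i * ind p' k) * (ind q j * ind q' l) * xx i j k l U := by
  simp only [trunc_eq]
  rw [Finset.sum_mul_sum]
  refine Finset.sum_congr rfl fun i _ => Finset.sum_congr rfl fun k _ => ?_
  rw [Finset.sum_mul_sum]
  refine Finset.sum_congr rfl fun j _ => Finset.sum_congr rfl fun l _ => ?_
  simp only [xx]
  ring

lemma sum4 (f g : Fin n → Fin n → ℝ) :
    ∑ i, ∑ k, ∑ j, ∑ l, f i k * g j l = (∑ i, ∑ k, f i k) * ∑ j, ∑ l, g j l := by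
  simp only [← Finset.mul_sum, ← Finset.sum_mul]

lemma trunc_mul_int (hn : 2 ≤ n) {p q p' q' : ℕ} (hp : p ≤ n) (hq : q ≤ n) (hp' : p' ≤ n)
    (hq' : q' ≤ n) :
    ∫ U, truncTraceU n p q U * truncTraceU n p' q' U ∂ν =
    (p * p' * (q * q') + (min p p' : ℕ) * (min q q' : ℕ) -
      ((min p p' : ℕ) * (q * q') + p * p' * (min q q' : ℕ)) / n) / ((n:ℝ)^2 - 1) := by
  simp only [trunc_mul]
  have h0 : ∀ i j k l, Continuous (fun U : Matrix.unitaryGroup (Fin n) ℂ =>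
      (ind p i * ind p' k) * (ind q j * ind q' l) * xx i j k l U) := fun i j k l =>
    continuous_const.mul (xx_cont i j k l)
  have h1 := fun i j k => continuous_finsetSum Finset.univ fun l _ => h0 i j k l
  have h2 := fun i k => continuous_finsetSum Finset.univ fun j _ => h1 i j k
  have h3 := fun i => continuous_finsetSum Finset.univ fun k _ => h2 i k
  rw [integral_finsetSum _ fun i _ => u_int ν (h3 i)]
  simp only [integral_finsetSum _ fun k _ => u_int ν (h2 _ k),
    integral_finsetSum _ fun j _ => u_int ν (h1 _ j _),
    integral_finsetSum _ fun l _ => u_int ν (h0 _ _ _ l), integral_const_mul, xx_M ν hn]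
  have e : ∀ i k j l : Fin n, (ind p i * ind p' k) * (ind q j * ind q' l) *
      ((1 + dl i k * dl j l - (dl i k + dl j l) / n) / ((n:ℝ)^2 - 1)) =
      ((ind p i * ind p' k) * (ind q j * ind q' l)
       + (ind p i * ind p' k * dl i k) * (ind q j * ind q' l * dl j l)
       - ((ind p i * ind p' k * dl i k) * (ind q j * ind q' l)
       + (ind p i * ind p' k) * (ind q j * ind q' l * dl j l)) / n) / ((n:ℝ)^2 - 1) := by
    intros; ring
  simp only [e, ← Finset.sum_div, Finset.sum_sub_distrib, Finset.sum_add_distrib]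
  rw [sum4 (fun i k => ind p i * ind p' k) (fun j l => ind q j * ind q' l),
    sum4 (fun i k => ind p i * ind p' k * dl i k) (fun j l => ind q j * ind q' l * dl j l),
    sum4 (fun i k => ind p i * ind p' k * dl i k) (fun j l => ind q j * ind q' l),
    sum4 (fun i k => ind p i * ind p' k) (fun j l => ind q j * ind q' l * dl j l),
    ind_one hp hp', ind_one hq hq', ind_dl hp, ind_dl hq]

end

/-- If `U⁽ⁿ⁾` is Haar distributed on `U(n)` and `p(n)/n → s`, `p'(n)/n → s'`,
`q(n)/n → t`, `q'(n)/n → t'` with all sequences in `{1,…,n}` and `s, s', t, t' ∈ [0,1]`, then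
`Cov(T_{p(n),q(n)}, T_{p'(n),q'(n)}) → (s∧s' - ss')(t∧t' - tt')`,
where `Cov(X, Y) = E[XY] - E[X]E[Y]`. -/
theorem limit_covariance_truncTraceU
    (μ : ∀ n : ℕ, Measure (Matrix.unitaryGroup (Fin n) ℂ))
    (hHaar : ∀ n, (μ n).IsHaarMeasure) (hProb : ∀ n, IsProbabilityMeasure (μ n))
    (p p' q q' : ℕ → ℕ)
    (hp : ∀ n, 2 ≤ n → 1 ≤ p n ∧ p n ≤ n) (hp' : ∀ n, 2 ≤ n → 1 ≤ p' n ∧ p' n ≤ n)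
    (hq : ∀ n, 2 ≤ n → 1 ≤ q n ∧ q n ≤ n) (hq' : ∀ n, 2 ≤ n → 1 ≤ q' n ∧ q' n ≤ n)
    (s s' t t' : ℝ) (hs : s ∈ Set.Icc (0 : ℝ) 1) (hs' : s' ∈ Set.Icc (0 : ℝ) 1)
    (ht : t ∈ Set.Icc (0 : ℝ) 1) (ht' : t' ∈ Set.Icc (0 : ℝ) 1)
    (hps : Tendsto (fun n : ℕ => (p n : ℝ) / n) atTop (nhds s))
    (hps' : Tendsto (fun n : ℕ => (p' n : ℝ) / n) atTop (nhds s'))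
    (hqt : Tendsto (fun n : ℕ => (q n : ℝ) / n) atTop (nhds t))
    (hqt' : Tendsto (fun n : ℕ => (q' n : ℝ) / n) atTop (nhds t')) :
    Tendsto (fun n : ℕ =>
        (∫ U, truncTraceU n (p n) (q n) U * truncTraceU n (p' n) (q' n) U ∂(μ n)) -
          (∫ U, truncTraceU n (p n) (q n) U ∂(μ n)) *
            (∫ U, truncTraceU n (p' n) (q' n) U ∂(μ n)))
      atTop (nhds ((min s s' - s * s') * (min t t' - t * t'))) := by
  have h1 : Tendsto (fun n : ℕ => ((min ((p n : ℝ) / n) (p' n / n) - (p n / n) * (p' n / n)) *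
      (min ((q n : ℝ) / n) (q' n / n) - (q n / n) * (q' n / n))) *
      (1 / (1 - ((1 : ℝ) / n) ^ 2))) atTop
      (nhds (((min s s' - s * s') * (min t t' - t * t')) * (1 / (1 - 0 ^ 2)))) := by
    refine (((hps.min hps').sub (hps.mul hps')).mul ((hqt.min hqt').sub (hqt.mul hqt'))).mul ?_
    refine tendsto_const_nhds.div (tendsto_const_nhds.sub ?_) (by norm_num)
    exact tendsto_one_div_atTop_nhds_zero_nat.pow 2
  have e0 : (1 : ℝ) / (1 - 0 ^ 2) = 1 := by norm_num
  rw [e0, mul_one] at h1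
  refine h1.congr' ?_
  filter_upwards [eventually_ge_atTop 2] with n hn
  have := hProb n
  have := hHaar n
  rw [trunc_mul_int (μ n) hn (hp n hn).2 (hq n hn).2 (hp' n hn).2 (hq' n hn).2,
    trunc_int (μ n) (hp n hn).2 (hq n hn).2, trunc_int (μ n) (hp' n hn).2 (hq' n hn).2]
  have hn' : (2 : ℝ) ≤ n := by exact_mod_cast hn
  have e1 : (n:ℝ) ≠ 0 := by positivity
  have e2 : (n:ℝ)^2 - 1 ≠ 0 := by nlinarith
  have e3 : 1 - ((1:ℝ) / n)^2 = ((n:ℝ)^2 - 1) / n^2 := by field_simp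
  rw [e3, min_div_div_right (by positivity), min_div_div_right (by positivity)]
  push_cast
  field_simp
  ring
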